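/- arXiv:2603.13311 — 2 statements merged into one kernel-verified Lean document; each statement's English description precedes it below -/
import Mathlib

section
/- Let σ : ℝ → ℝ be a continuous function that is not affine (there is no pair a, b ∈ ℝ with σ(t) = a·t + b for all t) and that is differentiable at at least one point x₀ ∈ ℝ with σ'(x₀) ≠ 0. Then for every continuous function g : [0,1] → ℝ and every ε > 0, there exists a multilayer perceptron f_θ with activation σ, i.e. a function of the form f_θ(x) = W_L(σ*(⋯ σ*(W_0 x + b_0) ⋯)) + b_L, where L ∈ ℕ, W_l ∈ ℝ^{h_{l+1} × h_l} and b_l ∈ ℝ^{h_{l+1}} with h_0 = 1 and h_{L+1} = 1, and σ* denotes componentwise application of σ, such that sup_{x ∈ [0,1]} |f_θ(x) − g(x)| < ε. -/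
/-- A multilayer perceptron with activation `σ`: an alternating composition of
affine maps `x ↦ W x + b` and the componentwise application of `σ`, beginning
and ending with an affine map. -/
inductive IsMLP (σ : ℝ → ℝ) : {a b : ℕ} → ((Fin a → ℝ) → (Fin b → ℝ)) → Prop
  | affine {a b : ℕ} (W : Matrix (Fin b) (Fin a) ℝ) (v : Fin b → ℝ) :
      IsMLP σ (fun x => W.mulVec x + v)
  | layer {a b c : ℕ} (W : Matrix (Fin c) (Fin b) ℝ) (v : Fin c → ℝ)
      {F : (Fin a → ℝ) → (Fin b → ℝ)} (hF : IsMLP σ F) :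
      IsMLP σ (fun x => W.mulVec (fun i => σ (F x i)) + v)

open Filter Topology Asymptotics

namespace ContinuousMap

section Invariant

variable {X : Type*} [TopologicalSpace X] [CompactSpace X] {A : Submodule ℝ C(X, ℝ)}

/-- A closed subspace of `C(X, ℝ)` containing all `φ ∘ (r • f)` contains `f ^ n` if `φ s` is
equivalent to a nonzero multiple of `s ^ n` at `0`. -/
lemma pow_mem_of_isLittleO (hA : IsClosed (A : Set C(X, ℝ))) (φ : C(ℝ, ℝ)) {a : ℝ} (ha : a ≠ 0)
    (n : ℕ) (hφ : (fun s => φ s - a * s ^ n) =o[𝓝 0] fun s => s ^ n) (f : C(X, ℝ))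
    (h : ∀ r : ℝ, φ.comp (r • f) ∈ A) : f ^ n ∈ A := by
  refine hA.mem_of_tendsto (f := fun r : ℝ => (a * r ^ n)⁻¹ • φ.comp (r • f)) (b := 𝓝[≠] 0) ?_
    (Eventually.of_forall fun r => A.smul_mem _ (h r))
  rw [Metric.tendsto_nhds]
  intro ε hε
  have hapos : 0 < |a| := abs_pos.2 ha
  set c := ε * |a| / (2 * (‖f‖ ^ n + 1)) with hc
  have hcpos : 0 < c := by positivity
  obtain ⟨δ, hδ, hball⟩ := Metric.eventually_nhds_iff.1 (hφ.def hcpos)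
  have hsmall : ∀ᶠ r : ℝ in 𝓝[≠] 0, |r| < δ / (‖f‖ + 1) := by
    refine nhdsWithin_le_nhds (Metric.eventually_nhds_iff.2 ⟨δ / (‖f‖ + 1), by positivity, ?_⟩)
    intro r hr
    simpa using hr
  filter_upwards [hsmall, self_mem_nhdsWithin] with r hr hr0
  have hr0 : 0 < |r| := abs_pos.2 hr0
  refine lt_of_le_of_lt ((dist_le (by positivity : (0 : ℝ) ≤ ε / 2)).2 fun x => ?_)
    (half_lt_self hε)
  have hfx : |f x| ≤ ‖f‖ := f.norm_coe_le_norm x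
  have hrf : |r * f x| < δ := by
    rw [abs_mul]
    rw [lt_div_iff₀ (by positivity)] at hr
    nlinarith
  have hrem := hball (y := r * f x) (by simpa using hrf)
  rw [Real.norm_eq_abs, Real.norm_eq_abs, abs_pow, abs_mul] at hrem
  have hrn : a * r ^ n ≠ 0 := mul_ne_zero ha (pow_ne_zero _ (abs_pos.1 hr0))
  have hsub : (a * r ^ n)⁻¹ * φ (r * f x) - f x ^ n
      = (a * r ^ n)⁻¹ * (φ (r * f x) - a * (r * f x) ^ n) := by
    rw [mul_pow, mul_sub, ← mul_assoc a, inv_mul_cancel_left₀ hrn]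
  have hbound : c * (|r| * |f x|) ^ n ≤ |a * r ^ n| * (ε / 2) := by
    have hpow : |f x| ^ n ≤ ‖f‖ ^ n + 1 :=
      (pow_le_pow_left₀ (abs_nonneg _) hfx n).trans (by simp)
    have hc' : c * (‖f‖ ^ n + 1) = |a| * (ε / 2) := by
      rw [hc]; field_simp
    rw [mul_pow, abs_mul, abs_pow]
    calc c * (|r| ^ n * |f x| ^ n) ≤ c * (|r| ^ n * (‖f‖ ^ n + 1)) := by gcongr
      _ = |a| * |r| ^ n * (ε / 2) := by linear_combination |r| ^ n * hc'
  simp only [Real.dist_eq, coe_smul, Pi.smul_apply, comp_apply, smul_eq_mul, coe_pow, Pi.pow_apply]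
  rw [hsub, abs_mul, abs_inv, inv_mul_le_iff₀ (abs_pos.2 hrn)]
  exact hrem.trans hbound

lemma mem_of_hasDerivAt (hA : IsClosed (A : Set C(X, ℝ))) (h1 : 1 ∈ A) (φ : C(ℝ, ℝ))
    {x₀ d : ℝ} (hd : HasDerivAt φ d x₀) (hd0 : d ≠ 0) (f : C(X, ℝ))
    (h : ∀ r : ℝ, φ.comp (x₀ • 1 + r • f) ∈ A) : f ∈ A := by
  have key := pow_mem_of_isLittleO hA ⟨fun s => φ (x₀ + s) - φ x₀, by fun_prop⟩ hd0 1 ?_ f ?_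
  · simpa using key
  · simpa [mul_comm] using hasDerivAt_iff_isLittleO_nhds_zero.1 hd
  · intro r
    convert A.sub_mem (h r) (A.smul_mem (φ x₀) h1) using 1
    ext x
    simp

/-- Invariance of a closed subspace under `φ` passes to the increments of an antiderivative. -/
lemma comp_sub_antideriv_mem (hA : IsClosed (A : Set C(X, ℝ))) (h1 : 1 ∈ A) {φ P Q : C(ℝ, ℝ)}
    (hφ : ∀ f ∈ A, φ.comp f ∈ A) (hP : ∀ x, HasDerivAt P (φ x) x) (h : ℝ)
    (hQ : ∀ x, Q x = P (x + h) - P x) {f : C(X, ℝ)} (hf : f ∈ A) : Q.comp f ∈ A := by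
  have : CompleteSpace A := hA.completeSpace_coe
  let F : ℝ → A := fun t => ⟨φ.comp (f + t • 1), hφ _ (A.add_mem hf (A.smul_mem t h1))⟩
  have hF : Continuous F := by
    refine Continuous.subtype_mk (φ.continuous_postcomp.comp ?_) _
    fun_prop
  convert (∫ t in (0 : ℝ)..h, F t).2 using 1
  ext x
  let E : A →L[ℝ] ℝ := (evalCLM ℝ x).comp A.subtypeL
  have hcomm := E.intervalIntegral_comp_comm (𝕜 := ℝ)
    (hF.intervalIntegrable (μ := MeasureTheory.volume) 0 h)
  have hFTC : ∫ t in (0 : ℝ)..h, φ (f x + t) = P (f x + h) - P (f x) := by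
    rw [intervalIntegral.integral_comp_add_left (fun t => φ t), add_zero]
    exact intervalIntegral.integral_eq_sub_of_hasDerivAt (fun t _ => hP t)
      (φ.continuous.intervalIntegrable _ _)
  calc Q (f x) = ∫ t in (0 : ℝ)..h, φ (f x + t) := by rw [hQ, hFTC]
    _ = ∫ t in (0 : ℝ)..h, E (F t) := by simp [F, E]
    _ = _ := hcomm

lemma exists_antideriv (φ : C(ℝ, ℝ)) : ∃ P : C(ℝ, ℝ), ∀ x, HasDerivAt P (φ x) x := by
  have hP : ∀ x, HasDerivAt (fun y => ∫ t in (0 : ℝ)..y, φ t) (φ x) x := fun x =>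
    φ.continuous.integral_hasStrictDerivAt 0 x |>.hasDerivAt
  exact ⟨⟨_, continuous_iff_continuousAt.2 fun x => (hP x).continuousAt⟩, hP⟩

lemma isLittleO_taylor_two {τ τ' : ℝ → ℝ} {c b : ℝ} (hτ : ∀ x, HasDerivAt τ (τ' x) x)
    (hτ' : HasDerivAt τ' b c) :
    (fun s => τ (c + s) - τ c - τ' c * s - b / 2 * s ^ 2) =o[𝓝 0] fun s => s ^ 2 := by
  have hderiv : ∀ s : ℝ, HasDerivAt (fun s => τ (c + s) - τ c - τ' c * s - b / 2 * s ^ 2)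
      (τ' (c + s) - τ' c - b * s) s := by
    intro s
    have hshift : HasDerivAt (fun s => τ (c + s)) (τ' (c + s)) s := (hτ (c + s)).comp_const_add c s
    have := ((hshift.sub_const (τ c)).sub ((hasDerivAt_id s).const_mul (τ' c))).sub
      ((hasDerivAt_pow 2 s).const_mul (b / 2))
    convert! this using 1
    push_cast
    ring
  have hlin : (fun s => τ' (c + s) - τ' c - b * s) =o[𝓝 0] fun s => s := by
    simpa [mul_comm] using hasDerivAt_iff_isLittleO_nhds_zero.1 hτ'
  have := convex_univ.isLittleO_pow_succ_real (Set.mem_univ (0 : ℝ)) (n := 1)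
    (fun s _ => (hderiv s).hasDerivWithinAt) (by simpa using hlin)
  simpa using this

lemma exists_second_difference_ne_zero {σ : ℝ → ℝ} (hσ : Continuous σ)
    (hna : ¬ ∃ a b : ℝ, ∀ t, σ t = a * t + b) :
    ∃ h k : ℝ, σ (k + h) - σ k - (σ h - σ 0) ≠ 0 := by
  by_contra! H
  let L := AddMonoidHom.toRealLinearMap
    (AddMonoidHom.mk' (fun t => σ t - σ 0) fun k h => by linear_combination H h k)
    (hσ.sub continuous_const)
  refine hna ⟨σ 1 - σ 0, σ 0, fun t => ?_⟩
  have hL : L (t • 1) = t • L 1 := L.map_smul t 1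
  simp only [smul_eq_mul, mul_one] at hL
  have hL' : σ t - σ 0 = t * (σ 1 - σ 0) := hL
  linear_combination hL'

lemma sq_mem_of_invariant (hA : IsClosed (A : Set C(X, ℝ))) (h1 : 1 ∈ A) (σ : C(ℝ, ℝ))
    (hσ : ∀ f ∈ A, σ.comp f ∈ A) (hna : ¬ ∃ a b : ℝ, ∀ t, σ t = a * t + b)
    {f : C(X, ℝ)} (hf : f ∈ A) : f ^ 2 ∈ A := by
  obtain ⟨h, k, hhk⟩ := exists_second_difference_ne_zero σ.continuous hna
  obtain ⟨P, hP⟩ := exists_antideriv σ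
  let Q : C(ℝ, ℝ) := ⟨fun x => P (x + h) - P x, by fun_prop⟩
  obtain ⟨R, hR⟩ := exists_antideriv Q
  let τ : C(ℝ, ℝ) := ⟨fun x => R (x + k) - R x, by fun_prop⟩
  have hτA : ∀ g ∈ A, τ.comp g ∈ A := fun g hg =>
    comp_sub_antideriv_mem hA h1
      (fun _ => comp_sub_antideriv_mem hA h1 hσ hP h fun _ => rfl) hR k (fun _ => rfl) hg
  have hτ : ∀ x, HasDerivAt τ (Q (x + k) - Q x) x := fun x =>
    ((hR (x + k)).comp_add_const x k).sub (hR x)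
  have hQ : ∀ x, HasDerivAt Q (σ (x + h) - σ x) x := fun x =>
    ((hP (x + h)).comp_add_const x h).sub (hP x)
  have hτ' : HasDerivAt (fun x => Q (x + k) - Q x) (σ (k + h) - σ k - (σ h - σ 0)) 0 := by
    convert! ((hQ (0 + k)).comp_add_const 0 k).sub (hQ 0) using 1
    simp
  have hO := isLittleO_taylor_two hτ hτ'
  refine pow_mem_of_isLittleO hA ⟨fun s => τ (0 + s) - τ 0 - (Q (0 + k) - Q 0) * s, by fun_prop⟩
    (div_ne_zero hhk two_ne_zero) 2 hO f fun r => ?_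
  convert A.sub_mem (A.sub_mem (hτA _ (A.smul_mem r hf)) (A.smul_mem (τ 0) h1))
    (A.smul_mem ((Q (0 + k) - Q 0) * r) hf) using 1
  ext x
  simp [mul_assoc]

/-- A closed subspace of `C(X, ℝ)` invariant under a continuous non-affine function is everything
as soon as it contains the constants and separates points. -/
lemma eq_top_of_invariant (hA : IsClosed (A : Set C(X, ℝ))) (h1 : 1 ∈ A) (σ : C(ℝ, ℝ))
    (hσ : ∀ f ∈ A, σ.comp f ∈ A) (hna : ¬ ∃ a b : ℝ, ∀ t, σ t = a * t + b)
    (hsep : ∀ x y : X, x ≠ y → ∃ f ∈ A, f x ≠ f y) : A = ⊤ := by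
  have hsq : ∀ {f}, f ∈ A → f ^ 2 ∈ A := sq_mem_of_invariant hA h1 σ hσ hna
  have hmul : ∀ f g, f ∈ A → g ∈ A → f * g ∈ A := by
    intro f g hf hg
    convert A.smul_mem (1 / 2 : ℝ)
      (A.sub_mem (A.sub_mem (hsq (A.add_mem hf hg)) (hsq hf)) (hsq hg)) using 1
    ext x
    simp
    ring
  let B : Subalgebra ℝ C(X, ℝ) := A.toSubalgebra h1 hmul
  have hB := subalgebra_topologicalClosure_eq_top_of_separatesPoints B fun x y hxy => by
    obtain ⟨f, hf, hne⟩ := hsep x y hxy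
    exact ⟨f, ⟨f, hf, rfl⟩, hne⟩
  refine eq_top_iff.2 fun f _ => ?_
  have hf : f ∈ B.topologicalClosure := hB ▸ trivial
  exact hA.closure_subset hf

end Invariant

end ContinuousMap

section Networks

open ContinuousMap

/-- The restrictions to `K` of scalar networks with `L` hidden layers. -/
noncomputable def networkSpace (σ : C(ℝ, ℝ)) (K : Set ℝ) : ℕ → Submodule ℝ C(K, ℝ)
  | 0 => Submodule.span ℝ {1, (ContinuousMap.id ℝ).restrict K}
  | L + 1 => Submodule.span ℝ (insert 1 (σ.comp '' (networkSpace σ K L)))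

variable {σ : C(ℝ, ℝ)} {K : Set ℝ}

lemma one_mem_networkSpace (L : ℕ) : 1 ∈ networkSpace σ K L := by
  cases L <;> exact Submodule.subset_span (Set.mem_insert _ _)

lemma comp_mem_networkSpace {L : ℕ} {f : C(K, ℝ)} (hf : f ∈ networkSpace σ K L) :
    σ.comp f ∈ networkSpace σ K (L + 1) :=
  Submodule.subset_span (Set.mem_insert_of_mem _ ⟨f, hf, rfl⟩)

/-- Finitely many elements of the span of `s` are combinations of one finite family in `s`. -/
lemma exists_common_combination {V ι : Type*} [AddCommGroup V] [Module ℝ V] [Finite ι] {s : Set V}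
    {f : ι → V} (hf : ∀ j, f j ∈ Submodule.span ℝ s) :
    ∃ (b : ℕ) (u : Fin b → V) (W : ι → Fin b → ℝ),
      (∀ i, u i ∈ s) ∧ ∀ j, f j = ∑ i, W j i • u i := by
  classical
  have := Fintype.ofFinite ι
  choose t hts hft using fun j => Submodule.mem_span_finite_of_mem_span (hf j)
  let T := Finset.univ.biUnion t
  let e := T.equivFin
  have hT : ∀ j, f j ∈ Submodule.span ℝ (Set.range fun i => (e.symm i : V)) := by
    intro j
    refine Submodule.span_mono (fun v hv => ?_) (hft j)
    exact ⟨e ⟨v, Finset.mem_biUnion.2 ⟨j, Finset.mem_univ j, hv⟩⟩, by simp⟩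
  choose W hW using fun j => (Submodule.mem_span_range_iff_exists_fun ℝ).1 (hT j)
  refine ⟨_, fun i => e.symm i, W, fun i => ?_, fun j => (hW j).symm⟩
  obtain ⟨j, -, hj⟩ := Finset.mem_biUnion.1 (e.symm i).2
  exact hts j hj

lemma exists_isMLP_of_mem_networkSpace (L : ℕ) {c : ℕ} (f : Fin c → C(K, ℝ))
    (hf : ∀ j, f j ∈ networkSpace σ K L) :
    ∃ F : (Fin 1 → ℝ) → (Fin c → ℝ), IsMLP σ F ∧ ∀ (x : K) j, F (fun _ => x) j = f j x := by
  induction L generalizing c with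
  | zero =>
    choose v w hvw using fun j => Submodule.mem_span_pair.1 (hf j)
    refine ⟨_, IsMLP.affine (.of fun j _ => w j) v, fun x j => ?_⟩
    simp [← hvw j, Matrix.mulVec, dotProduct, add_comm]
  | succ L ih =>
    choose v g hg hvg using fun j => Submodule.mem_span_insert.1 (hf j)
    obtain ⟨b, u, W, hu, hW⟩ := exists_common_combination hg
    choose u' hu' hu'' using hu
    obtain ⟨F, hF, hFu⟩ := ih u' hu'
    refine ⟨_, IsMLP.layer (.of W) v hF, fun x j => ?_⟩
    simp [hvg j, hW j, Matrix.mulVec, dotProduct, hFu, ← hu'', add_comm]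

lemma closure_iUnion_networkSpace [CompactSpace K] {x₀ d : ℝ} (hd : HasDerivAt σ d x₀)
    (hd0 : d ≠ 0) (hna : ¬ ∃ a b : ℝ, ∀ t, σ t = a * t + b) :
    closure (⋃ L, (networkSpace σ K L : Set C(K, ℝ))) = Set.univ := by
  have hmono : Monotone fun L => (networkSpace σ K L).topologicalClosure := by
    refine monotone_nat_of_le_succ fun L =>
      Submodule.topologicalClosure_minimal _ (fun f hf => ?_) (Submodule.isClosed_topologicalClosure _)
    refine mem_of_hasDerivAt (Submodule.isClosed_topologicalClosure _)
      (Submodule.le_topologicalClosure _ (one_mem_networkSpace _)) σ hd hd0 f fun r => ?_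
    exact Submodule.le_topologicalClosure _ (comp_mem_networkSpace
      (add_mem (Submodule.smul_mem _ _ (one_mem_networkSpace L)) (Submodule.smul_mem _ _ hf)))
  let A := (⨆ L, (networkSpace σ K L).topologicalClosure).topologicalClosure
  have hA : (A : Set C(K, ℝ)) = closure (⋃ L, (networkSpace σ K L : Set C(K, ℝ))) := by
    rw [Submodule.topologicalClosure_coe, Submodule.coe_iSup_of_directed _ hmono.directed_le]
    refine subset_antisymm (closure_minimal (Set.iUnion_subset fun L => ?_) isClosed_closure)
      (closure_mono (Set.iUnion_mono fun L => Submodule.le_topologicalClosure _))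
    exact closure_mono (Set.subset_iUnion (fun L => (networkSpace σ K L : Set C(K, ℝ))) L)
  have hsub : ∀ L, ∀ f ∈ networkSpace σ K L, f ∈ A := fun L f hf =>
    hA.superset (subset_closure (Set.mem_iUnion.2 ⟨L, hf⟩))
  rw [← hA, eq_top_of_invariant (A := A) (Submodule.isClosed_topologicalClosure _)
    (hsub 0 1 (one_mem_networkSpace 0)) σ ?_ hna ?_, Submodule.top_coe]
  · intro f hf
    rw [← SetLike.mem_coe, hA] at hf ⊢
    refine map_mem_closure σ.continuous_postcomp hf fun g hg => ?_
    obtain ⟨L, hL⟩ := Set.mem_iUnion.1 hg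
    exact Set.mem_iUnion.2 ⟨L + 1, comp_mem_networkSpace hL⟩
  · intro x y hxy
    refine ⟨(ContinuousMap.id ℝ).restrict K, hsub 0 _ (Submodule.subset_span (by simp)), ?_⟩
    simpa [Subtype.ext_iff] using hxy

end Networks

/-- Universal Approximation Theorem, Kidger–Lyons. If
`σ : ℝ → ℝ` is continuous, not affine, and differentiable at some point with
nonzero derivative there, then every continuous `g : [0,1] → ℝ` is uniformly
approximated within any `ε > 0` by a multilayer perceptron with activation `σ`
(scalar input and scalar output). -/
theorem universal_approximation (σ : ℝ → ℝ) (hσc : Continuous σ)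
    (hσna : ¬ ∃ a b : ℝ, ∀ t : ℝ, σ t = a * t + b)
    (hσd : ∃ (x₀ d : ℝ), HasDerivAt σ d x₀ ∧ d ≠ 0)
    (g : ℝ → ℝ) (hg : ContinuousOn g (Set.Icc (0 : ℝ) 1))
    (ε : ℝ) (hε : 0 < ε) :
    ∃ F : (Fin 1 → ℝ) → (Fin 1 → ℝ), IsMLP σ F ∧
      ∀ x ∈ Set.Icc (0 : ℝ) 1, |F (fun _ => x) 0 - g x| < ε := by
  obtain ⟨x₀, d, hd, hd0⟩ := hσd
  let s : C(ℝ, ℝ) := ⟨σ, hσc⟩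
  let G : C(Set.Icc (0 : ℝ) 1, ℝ) := ⟨_, hg.domRestrict⟩
  have hG : G ∈ closure (⋃ L, (networkSpace s (Set.Icc 0 1) L : Set C(Set.Icc (0 : ℝ) 1, ℝ))) := by
    rw [closure_iUnion_networkSpace (σ := s) hd hd0 hσna]
    trivial
  obtain ⟨f, hf, hdist⟩ := Metric.mem_closure_iff.1 hG ε hε
  obtain ⟨L, hL⟩ := Set.mem_iUnion.1 hf
  obtain ⟨F, hF, hFf⟩ := exists_isMLP_of_mem_networkSpace (σ := s) L (fun _ : Fin 1 => f) fun _ => hL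
  refine ⟨F, hF, fun x hx => ?_⟩
  rw [hFf ⟨x, hx⟩ 0, ← Real.dist_eq, dist_comm]
  exact (ContinuousMap.dist_apply_le_dist (f := G) ⟨x, hx⟩).trans_lt hdist
end

section
/- Let σ : ℝ → ℝ be a continuous function that is not affine and that is differentiable at at least one point with nonzero derivative there. Then for every R ∈ ℕ, every continuous vector-valued function g : [0,1] → ℝ^R, and every ε > 0, there exists a multilayer perceptron f_θ : [0,1] → ℝ^R with activation σ, i.e. a function of the form f_θ(x) = W_L(σ*(⋯ σ*(W_0 x + b_0) ⋯)) + b_L with h_0 = 1 and h_{L+1} = R and σ* applied componentwise, such that sup_{x ∈ [0,1]} max_{1 ≤ k ≤ R} |(f_θ(x))_k − (g(x))_k| < ε. -/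
open MeasureTheory intervalIntegral

/-- The integral of a continuous function over the sliding window from `x` to `x + δ`. -/
noncomputable def windowIntegral (δ : ℝ) (h : C(ℝ, ℝ)) : C(ℝ, ℝ) where
  toFun x := ∫ t in x..x + δ, h t
  continuous_toFun := by
    have hi : ∀ a b, IntervalIntegrable h volume a b := fun a b =>
      h.continuous.intervalIntegrable a b
    have hc : Continuous fun x => ∫ t in (0 : ℝ)..x, h t := continuous_primitive hi 0
    have he : (fun x => ∫ t in x..x + δ, h t) =
        fun x => (∫ t in (0 : ℝ)..x + δ, h t) - ∫ t in (0 : ℝ)..x, h t := by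
      ext x
      exact (integral_interval_sub_left (hi _ _) (hi _ _)).symm
    rw [he]
    exact (hc.comp (continuous_id.add continuous_const)).sub hc

theorem windowIntegral_apply (δ : ℝ) (h : C(ℝ, ℝ)) (x : ℝ) :
    windowIntegral δ h x = ∫ t in x..x + δ, h t := rfl

theorem hasDerivAt_windowIntegral (δ : ℝ) (h : C(ℝ, ℝ)) (x : ℝ) :
    HasDerivAt (windowIntegral δ h) (h (x + δ) - h x) x := by
  have hi : ∀ a b, IntervalIntegrable h volume a b := fun a b =>
    h.continuous.intervalIntegrable a b
  have hd : ∀ y, HasDerivAt (fun y => ∫ t in (0 : ℝ)..y, h t) (h y) y := fun y =>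
    h.continuous.integral_hasStrictDerivAt 0 y |>.hasDerivAt
  have he : ⇑(windowIntegral δ h) =
      fun x => (∫ t in (0 : ℝ)..x + δ, h t) - ∫ t in (0 : ℝ)..x, h t := by
    ext x
    exact (integral_interval_sub_left (hi _ _) (hi _ _)).symm
  rw [he]
  exact ((hd (x + δ)).comp_add_const x δ).sub (hd x)

/-- A continuous function with vanishing symmetric second differences is affine. -/
theorem exists_affine_of_second_difference_eq_zero (σ : ℝ → ℝ) (hσ : Continuous σ)
    (h : ∀ x δ, σ (x + δ + δ) - σ (x + δ) - (σ (x + δ) - σ x) = 0) :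
    ∃ a b : ℝ, ∀ t, σ t = a * t + b := by
  have hmid : ∀ x y, σ (midpoint ℝ x y) = midpoint ℝ (σ x) (σ y) := by
    intro x y
    have := h x ((y - x) / 2)
    rw [midpoint_eq_smul_add, midpoint_eq_smul_add]
    simp only [smul_eq_mul, invOf_eq_inv]
    rw [show x + (y - x) / 2 + (y - x) / 2 = y by ring,
      show x + (y - x) / 2 = 2⁻¹ * (x + y) by ring] at this
    linarith
  let L := AffineMap.ofMapMidpoint σ hmid hσ
  refine ⟨L.linear 1, σ 0, fun t => ?_⟩
  have h1 : L t = L.linear t + L 0 := by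
    have := L.map_vadd 0 t
    simpa using this
  have h2 : L.linear t = t * L.linear 1 := by
    have := L.linear.map_smul t 1
    simpa using this
  have h3 : L t = σ t := rfl
  have h4 : L 0 = σ 0 := rfl
  rw [← h3, h1, h2, h4, mul_comm]

/-- Peano form of the second order expansion, symmetrized. -/
theorem exists_abs_second_difference_sub_le {G k : ℝ → ℝ} {c x₀ : ℝ}
    (hG : ∀ x, HasDerivAt G (k x) x) (hk : HasDerivAt k c x₀) {ε : ℝ} (hε : 0 < ε) :
    ∃ η > 0, ∀ v, |v| < η →
      |G (x₀ + v) + G (x₀ - v) - 2 * G x₀ - c * v ^ 2| ≤ ε * v ^ 2 := by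
  have hlo := (hasDerivAt_iff_isLittleO.1 hk).def (half_pos hε)
  obtain ⟨η, hη, hb⟩ := Metric.eventually_nhds_iff.1 hlo
  refine ⟨η, hη, fun v hv => ?_⟩
  have hbd : ∀ w, |w| < η → |k (x₀ + w) - k x₀ - w * c| ≤ ε / 2 * |w| := by
    intro w hw
    have := hb (y := x₀ + w) (by simpa [Real.dist_eq] using hw)
    simpa using this
  let φ : ℝ → ℝ := fun w => G (x₀ + w) + G (x₀ - w) - 2 * G x₀ - c * w ^ 2
  have hφ : ∀ w, HasDerivAt φ (k (x₀ + w) - k (x₀ - w) - 2 * c * w) w := by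
    intro w
    have h1 := (hG (x₀ + w)).comp_const_add x₀ w
    have h2 := (hG (x₀ - w)).comp_const_sub x₀ w
    have h3 := ((hasDerivAt_id w).pow 2).const_mul c
    refine (((h1.add h2).sub_const (2 * G x₀)).sub h3).congr_deriv ?_
    simp
    ring
  have key := (convex_segment (𝕜 := ℝ) (0 : ℝ) v).norm_image_sub_le_of_norm_hasDerivWithin_le
    (f := φ) (f' := fun w => k (x₀ + w) - k (x₀ - w) - 2 * c * w) (C := ε * |v|)
    (fun w _ => (hφ w).hasDerivWithinAt) (fun w hw => by
      have hwv : |w| ≤ |v| := by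
        obtain ⟨a, b, ha, hb, hab, rfl⟩ := hw
        simp only [smul_eq_mul, mul_zero, zero_add, abs_mul, abs_of_nonneg hb]
        exact mul_le_of_le_one_left (abs_nonneg v) (by linarith)
      have h1 := hbd w (hwv.trans_lt hv)
      have h2 := hbd (-w) (by rw [abs_neg]; exact hwv.trans_lt hv)
      rw [abs_neg, ← sub_eq_add_neg] at h2
      rw [Real.norm_eq_abs]
      have h3 := abs_sub (k (x₀ + w) - k x₀ - w * c) (k (x₀ - w) - k x₀ - -w * c)
      have h4 : ε * |w| ≤ ε * |v| := mul_le_mul_of_nonneg_left hwv hε.le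
      calc _ = |k (x₀ + w) - k x₀ - w * c - (k (x₀ - w) - k x₀ - -w * c)| := by
            congr 1; ring
        _ ≤ _ := by linarith)
    (left_mem_segment ℝ 0 v) (right_mem_segment ℝ 0 v)
  have h0 : φ 0 = 0 := by simp only [φ]; simp; ring
  rw [h0, sub_zero, sub_zero, Real.norm_eq_abs, Real.norm_eq_abs, mul_assoc, ← abs_mul,
    ← sq, abs_of_nonneg (sq_nonneg v)] at key
  exact key

section Closed

variable {X : Type*} [TopologicalSpace X] [CompactSpace X]

theorem intervalIntegral_mem_of_isClosed {E : Type*} [NormedAddCommGroup E] [NormedSpace ℝ E]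
    [CompleteSpace E] {B : Submodule ℝ E} (hB : IsClosed (B : Set E)) {f : ℝ → E}
    (hf : Continuous f) (hmem : ∀ t, f t ∈ B) : ∫ t in (0 : ℝ)..1, f t ∈ B := by
  rw [integral_of_le zero_le_one]
  have : IsProbabilityMeasure (volume.restrict (Set.Ioc (0 : ℝ) 1)) := ⟨by simp⟩
  exact B.convex.integral_mem hB (Filter.Eventually.of_forall hmem)
    ((hf.intervalIntegrable 0 1).1)

/-- Composites with window integrals stay in a closed subspace containing all the composites
with the original function. -/
theorem windowIntegral_comp_mem {A B : Submodule ℝ C(X, ℝ)} (h1 : 1 ∈ A)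
    (hB : IsClosed (B : Set C(X, ℝ))) {h : C(ℝ, ℝ)} (hh : ∀ f ∈ A, h.comp f ∈ B) (δ : ℝ) :
    ∀ f ∈ A, (windowIntegral δ h).comp f ∈ B := by
  intro f hf
  let F : ℝ → C(X, ℝ) := fun t => h.comp (f + (δ * t) • 1)
  have hF : Continuous F := by
    refine ContinuousMap.continuous_of_continuous_uncurry _ ?_
    simp only [F, Function.uncurry_def]
    simp
    fun_prop
  have hmem : ∫ t in (0 : ℝ)..1, F t ∈ B :=
    intervalIntegral_mem_of_isClosed hB hF fun t => hh _ (A.add_mem hf (A.smul_mem _ h1))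
  have he : (windowIntegral δ h).comp f = δ • ∫ t in (0 : ℝ)..1, F t := by
    ext u
    have hev := (ContinuousMap.evalCLM ℝ u : C(X, ℝ) →L[ℝ] ℝ).intervalIntegral_comp_comm
      (hF.intervalIntegrable (μ := volume) 0 1)
    simp only [ContinuousMap.evalCLM_apply] at hev
    rw [ContinuousMap.smul_apply, ← hev, ContinuousMap.comp_apply, windowIntegral_apply,
      smul_eq_mul]
    simp [F]
  rw [he]
  exact B.smul_mem _ hmem

/-- If all composites of a continuous non-affine function with elements of `A` lie in the closed
subspace `B`, then so do the squares of elements of `A`. -/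
theorem sq_mem_of_comp_mem {A B : Submodule ℝ C(X, ℝ)} (h1 : 1 ∈ A)
    (hB : IsClosed (B : Set C(X, ℝ))) {σ : C(ℝ, ℝ)}
    (hσ : ¬ ∃ a b : ℝ, ∀ t : ℝ, σ t = a * t + b) (hcomp : ∀ f ∈ A, σ.comp f ∈ B) :
    ∀ f ∈ A, f ^ 2 ∈ B := by
  intro f hf
  obtain ⟨x₀, δ, hne⟩ : ∃ x δ, σ (x + δ + δ) - σ (x + δ) - (σ (x + δ) - σ x) ≠ 0 := by
    by_contra! hcon
    exact hσ (exists_affine_of_second_difference_eq_zero σ σ.continuous hcon)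
  set c := σ (x₀ + δ + δ) - σ (x₀ + δ) - (σ (x₀ + δ) - σ x₀)
  let G := windowIntegral δ (windowIntegral δ σ)
  have hGmem : ∀ f ∈ A, G.comp f ∈ B :=
    windowIntegral_comp_mem h1 hB (windowIntegral_comp_mem h1 hB hcomp δ) δ
  have hG := hasDerivAt_windowIntegral δ (windowIntegral δ σ)
  have hk : HasDerivAt (fun x => windowIntegral δ σ (x + δ) - windowIntegral δ σ x) c x₀ :=
    ((hasDerivAt_windowIntegral δ σ (x₀ + δ)).comp_add_const x₀ δ).sub
      (hasDerivAt_windowIntegral δ σ x₀)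
  suffices hc : c • f ^ 2 ∈ B by
    have := B.smul_mem c⁻¹ hc
    rwa [smul_smul, inv_mul_cancel₀ hne, one_smul] at this
  rw [← SetLike.mem_coe, ← hB.closure_eq, Metric.mem_closure_iff]
  intro ε hε
  have hM : 0 < ‖f‖ + 1 := by positivity
  obtain ⟨η, hη, hb⟩ := exists_abs_second_difference_sub_le hG hk
    (ε := ε / 2 / (‖f‖ + 1) ^ 2) (by positivity)
  set s := η / 2 / (‖f‖ + 1) with hs
  have hs0 : 0 < s := by positivity
  refine ⟨(s ^ 2)⁻¹ • (G.comp (x₀ • 1 + s • f) + G.comp (x₀ • 1 - s • f)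
    - (2 : ℝ) • G.comp (x₀ • 1)), ?_, ?_⟩
  · have hx : x₀ • (1 : C(X, ℝ)) ∈ A := A.smul_mem _ h1
    have hsf := A.smul_mem s hf
    exact B.smul_mem _ (B.sub_mem (B.add_mem (hGmem _ (A.add_mem hx hsf))
      (hGmem _ (A.sub_mem hx hsf))) (B.smul_mem _ (hGmem _ hx)))
  · refine lt_of_le_of_lt ((ContinuousMap.dist_le (half_pos hε).le).2 fun u => ?_)
      (half_lt_self hε)
    have hfu : |f u| ≤ ‖f‖ + 1 := (f.norm_coe_le_norm u).trans (by linarith)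
    have hv : |s * f u| < η := by
      rw [abs_mul, abs_of_pos hs0]
      calc s * |f u| ≤ s * (‖f‖ + 1) := by gcongr
        _ = η / 2 := by rw [hs]; field_simp
        _ < η := half_lt_self hη
    have hbu := hb _ hv
    rw [dist_comm, Real.dist_eq]
    simp only [ContinuousMap.smul_apply, ContinuousMap.sub_apply, ContinuousMap.add_apply,
      ContinuousMap.comp_apply, ContinuousMap.one_apply, ContinuousMap.pow_apply, smul_eq_mul,
      mul_one]
    have hs2 : (0 : ℝ) < s ^ 2 := by positivity
    have he : (s ^ 2)⁻¹ * (G (x₀ + s * f u) + G (x₀ - s * f u) - 2 * G x₀) - c * f u ^ 2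
        = (s ^ 2)⁻¹ * (G (x₀ + s * f u) + G (x₀ - s * f u) - 2 * G x₀ - c * (s * f u) ^ 2) := by
      field_simp
    rw [he, abs_mul, abs_of_pos (inv_pos.2 hs2)]
    calc _ ≤ (s ^ 2)⁻¹ * (ε / 2 / (‖f‖ + 1) ^ 2 * (s * f u) ^ 2) := by gcongr
      _ = ε / 2 * (|f u| ^ 2 / (‖f‖ + 1) ^ 2) := by rw [sq_abs]; field_simp
      _ ≤ ε / 2 * 1 := by
        gcongr
        exact div_le_one_of_le₀ (by gcongr) (by positivity)
      _ = ε / 2 := mul_one _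

/-- If all composites of a continuous non-affine function with elements of `A` lie in the closed
subspace `B` of `C(X, ℝ)`, then `A ≤ B`. -/
theorem le_of_comp_mem {A B : Submodule ℝ C(X, ℝ)} (h1 : 1 ∈ A)
    (hB : IsClosed (B : Set C(X, ℝ))) {σ : C(ℝ, ℝ)}
    (hσ : ¬ ∃ a b : ℝ, ∀ t : ℝ, σ t = a * t + b) (hcomp : ∀ f ∈ A, σ.comp f ∈ B) :
    A ≤ B := by
  intro f hf
  have hsq := sq_mem_of_comp_mem h1 hB hσ hcomp
  have := B.smul_mem (4⁻¹ : ℝ) (B.sub_mem (hsq _ (A.add_mem hf h1)) (hsq _ (A.sub_mem hf h1)))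
  convert this using 1
  ext u
  simp
  ring

end Closed

/-- Scalar functions on `[0,1]` computed by networks with `n` hidden layers. -/
noncomputable def layerSpan (σ : C(ℝ, ℝ)) : ℕ → Submodule ℝ C(unitInterval, ℝ)
  | 0 => Submodule.span ℝ {1, ⟨Subtype.val, continuous_subtype_val⟩}
  | n + 1 => Submodule.span ℝ (insert 1 (Set.image σ.comp (layerSpan σ n)))

theorem one_mem_layerSpan (σ : C(ℝ, ℝ)) (n : ℕ) : 1 ∈ layerSpan σ n := by
  cases n <;> exact Submodule.subset_span (Set.mem_insert _ _)

theorem exists_isMLP_of_mem_layerSpan (σ : C(ℝ, ℝ)) (n : ℕ) :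
    ∀ (m : ℕ) (f : Fin m → C(unitInterval, ℝ)), (∀ k, f k ∈ layerSpan σ n) →
      ∃ F : (Fin 1 → ℝ) → (Fin m → ℝ), IsMLP σ F ∧
        ∀ (x : unitInterval) (k : Fin m), F (fun _ => x) k = f k x := by
  induction n with
  | zero =>
    intro m f hf
    choose v w hvw using fun k => Submodule.mem_span_pair.1 (hf k)
    refine ⟨_, IsMLP.affine (Matrix.of fun k _ => w k) v, fun x k => ?_⟩
    rw [← hvw k]
    simp [Matrix.mulVec, dotProduct, add_comm]
  | succ n ih =>
    intro m f hf
    choose v z hz hvz using fun k => Submodule.mem_span_insert.1 (hf k)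
    choose l hlA hl using fun k => (Finsupp.mem_span_image_iff_linearCombination ℝ).1 (hz k)
    classical
    let T : Finset C(unitInterval, ℝ) := Finset.univ.biUnion fun k => (l k).support
    have hT : ∀ g ∈ T, g ∈ layerSpan σ n := by
      intro g hg
      obtain ⟨k, -, hk⟩ := Finset.mem_biUnion.1 hg
      exact hlA k hk
    let e := T.equivFin
    obtain ⟨F, hF, hFe⟩ := ih T.card (fun j => (e.symm j : C(unitInterval, ℝ)))
      fun j => hT _ (e.symm j).2
    refine ⟨_, IsMLP.layer (Matrix.of fun k j => l k (e.symm j)) v hF, fun x k => ?_⟩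
    have hs : z k = ∑ j, l k (e.symm j) • σ.comp (e.symm j : C(unitInterval, ℝ)) := by
      rw [← hl k, Finsupp.linearCombination_apply,
        Finsupp.sum_of_support_subset (s := T) _
          (Finset.subset_biUnion_of_mem (fun k => (l k).support) (Finset.mem_univ k)) _
          (by simp),
        ← Finset.sum_coe_sort T, ← e.symm.sum_comp]
    rw [hvz k, hs]
    simp [Matrix.mulVec, dotProduct, hFe, add_comm]

theorem comp_mem_topologicalClosure_layerSpan (σ : C(ℝ, ℝ)) (n : ℕ) :
    ∀ f ∈ (layerSpan σ n).topologicalClosure,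
      σ.comp f ∈ (layerSpan σ (n + 1)).topologicalClosure := fun _ hf =>
  map_mem_closure (σ.continuous_postcomp) hf fun g hg =>
    Submodule.subset_span (Set.mem_insert_of_mem _ ⟨g, hg, rfl⟩)

theorem monotone_topologicalClosure_layerSpan {σ : C(ℝ, ℝ)}
    (hσ : ¬ ∃ a b : ℝ, ∀ t : ℝ, σ t = a * t + b) :
    Monotone fun n => (layerSpan σ n).topologicalClosure :=
  monotone_nat_of_le_succ fun n =>
    le_of_comp_mem (Submodule.le_topologicalClosure _ (one_mem_layerSpan σ n))
      (Submodule.isClosed_topologicalClosure _) hσ (comp_mem_topologicalClosure_layerSpan σ n)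

theorem sq_mem_topologicalClosure_layerSpan {σ : C(ℝ, ℝ)}
    (hσ : ¬ ∃ a b : ℝ, ∀ t : ℝ, σ t = a * t + b) (n : ℕ) :
    ∀ f ∈ (layerSpan σ n).topologicalClosure,
      f ^ 2 ∈ (layerSpan σ (n + 1)).topologicalClosure :=
  sq_mem_of_comp_mem (Submodule.le_topologicalClosure _ (one_mem_layerSpan σ n))
    (Submodule.isClosed_topologicalClosure _) hσ (comp_mem_topologicalClosure_layerSpan σ n)

/-- The functions on `[0,1]` that are uniform limits of networks of some fixed depth. -/
noncomputable def limitSubalgebra {σ : C(ℝ, ℝ)}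
    (hσ : ¬ ∃ a b : ℝ, ∀ t : ℝ, σ t = a * t + b) : Subalgebra ℝ C(unitInterval, ℝ) where
  carrier := {f | ∃ n, f ∈ (layerSpan σ n).topologicalClosure}
  add_mem' := by
    rintro f g ⟨n, hf⟩ ⟨m, hg⟩
    have hmono := monotone_topologicalClosure_layerSpan hσ
    exact ⟨max n m, Submodule.add_mem _ (hmono (le_max_left n m) hf)
      (hmono (le_max_right n m) hg)⟩
  mul_mem' := by
    rintro f g ⟨n, hf⟩ ⟨m, hg⟩
    have hmono := monotone_topologicalClosure_layerSpan hσ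
    replace hf := hmono (le_max_left n m) hf
    replace hg := hmono (le_max_right n m) hg
    have hsq := sq_mem_topologicalClosure_layerSpan hσ (max n m)
    refine ⟨max n m + 1, ?_⟩
    have := Submodule.smul_mem _ (4⁻¹ : ℝ) (Submodule.sub_mem _
      (hsq _ (Submodule.add_mem _ hf hg)) (hsq _ (Submodule.sub_mem _ hf hg)))
    convert this using 1
    ext u
    simp
    ring
  algebraMap_mem' r := ⟨0, by
    rw [Algebra.algebraMap_eq_smul_one]
    exact Submodule.smul_mem _ r (Submodule.le_topologicalClosure _ (one_mem_layerSpan σ 0))⟩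

theorem topologicalClosure_limitSubalgebra {σ : C(ℝ, ℝ)}
    (hσ : ¬ ∃ a b : ℝ, ∀ t : ℝ, σ t = a * t + b) : (limitSubalgebra hσ).topologicalClosure = ⊤ := by
  apply ContinuousMap.subalgebra_topologicalClosure_eq_top_of_separatesPoints
  intro x y hxy
  refine ⟨_, ⟨⟨Subtype.val, continuous_subtype_val⟩, ⟨0, ?_⟩, rfl⟩, fun h => hxy (Subtype.ext h)⟩
  exact Submodule.le_topologicalClosure _ (Submodule.subset_span (by simp))

theorem exists_mem_layerSpan_dist_lt {σ : C(ℝ, ℝ)}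
    (hσ : ¬ ∃ a b : ℝ, ∀ t : ℝ, σ t = a * t + b) (g : C(unitInterval, ℝ)) {ε : ℝ} (hε : 0 < ε) :
    ∃ n₀, ∀ n ≥ n₀, ∃ f ∈ layerSpan σ n, dist g f < ε := by
  have hg : g ∈ closure (limitSubalgebra hσ : Set C(unitInterval, ℝ)) := by
    rw [← Subalgebra.topologicalClosure_coe, topologicalClosure_limitSubalgebra hσ]
    trivial
  obtain ⟨p, ⟨n₀, hp⟩, hgp⟩ := Metric.mem_closure_iff.1 hg (ε / 2) (half_pos hε)
  refine ⟨n₀, fun n hn => ?_⟩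
  obtain ⟨f, hf, hpf⟩ := Metric.mem_closure_iff.1
    (monotone_topologicalClosure_layerSpan hσ hn hp) (ε / 2) (half_pos hε)
  exact ⟨f, hf, by linarith [dist_triangle g p f]⟩

/-- vector-valued universal approximation. If `σ : ℝ → ℝ` is
continuous, not affine, and differentiable at some point with nonzero
derivative there, then every continuous `g : [0,1] → ℝ^R` is uniformly
(entrywise) approximated within any `ε > 0` by a multilayer perceptron
`F : [0,1] → ℝ^R` with activation `σ`. -/
theorem universal_approximation_vector (σ : ℝ → ℝ) (hσc : Continuous σ)
    (hσna : ¬ ∃ a b : ℝ, ∀ t : ℝ, σ t = a * t + b)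
    (hσd : ∃ (x₀ d : ℝ), HasDerivAt σ d x₀ ∧ d ≠ 0)
    (R : ℕ) (g : ℝ → Fin R → ℝ)
    (hg : ContinuousOn g (Set.Icc (0 : ℝ) 1))
    (ε : ℝ) (hε : 0 < ε) :
    ∃ F : (Fin 1 → ℝ) → (Fin R → ℝ), IsMLP σ F ∧
      ∀ x ∈ Set.Icc (0 : ℝ) 1, ∀ k : Fin R, |F (fun _ => x) k - g x k| < ε := by
  let s : C(ℝ, ℝ) := ⟨σ, hσc⟩
  let G : Fin R → C(unitInterval, ℝ) := fun k =>
    ⟨fun x => g x k, (continuous_apply k).comp (continuousOn_iff_continuous_domRestrict.1 hg)⟩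
  choose n₀ hn₀ using fun k => exists_mem_layerSpan_dist_lt (σ := s) hσna (G k) hε
  choose f hf hd using fun k => hn₀ k (Finset.univ.sup n₀) (Finset.le_sup (Finset.mem_univ k))
  obtain ⟨F, hF, hFf⟩ := exists_isMLP_of_mem_layerSpan s _ R f hf
  refine ⟨F, hF, fun x hx k => ?_⟩
  rw [hFf ⟨x, hx⟩ k, ← Real.dist_eq, dist_comm]
  exact (ContinuousMap.dist_apply_le_dist (f := G k) (g := f k) ⟨x, hx⟩).trans_lt (hd k)
end
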